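/- arXiv:1403.1666 — 2 statements merged into one kernel-verified Lean document; each statement's English description precedes it below -/
import Mathlib

section
/- Let φ be an LTLf formula and η = ω0…ωn (n ≥ 0) a finite trace. Then η ⊨ φ iff there exists a run φ = φ0 →α0 φ1 →α1 … →αn φ_{n+1} of T_φ on η whose last transition φ_n →αn φ_{n+1} satisfies CF(α_n) ⊨ φ_n, where CF(α_n) is viewed as a length-1 trace. -/
namespace LTLfPaper

/-- Literals over atomic propositions: `p` or `¬p`. -/
inductive Lit (P : Type) : Type
  | pos (p : P)
  | neg (p : P)

/-- A state is a set of literals; `Σ = 2^L`. -/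
abbrev State (P : Type) := Set (Lit P)

/-- LTLf formulas in negation normal form. -/
inductive LTLf (P : Type) : Type
  | tt
  | ff
  | pos (p : P)
  | neg (p : P)
  | and (φ ψ : LTLf P)
  | or (φ ψ : LTLf P)
  | next (φ : LTLf P)
  | wnext (φ : LTLf P)
  | untl (φ ψ : LTLf P)
  | rel (φ ψ : LTLf P)

/-- Finite-trace (LTLf) satisfaction: traces are (intended nonempty) lists of states;
the suffix `η_i` is `η.drop i`, and the first state `ω0` is `η.getD 0 ∅`. -/
def Sat {P : Type} : LTLf P → List (State P) → Prop
  | .tt, _ => True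
  | .ff, _ => False
  | .pos p, η => Lit.pos p ∈ η.getD 0 ∅
  | .neg p, η => Lit.neg p ∈ η.getD 0 ∅
  | .and φ ψ, η => Sat φ η ∧ Sat ψ η
  | .or φ ψ, η => Sat φ η ∨ Sat ψ η
  | .next φ, η => 1 < η.length ∧ Sat φ η.tail
  | .wnext φ, η => η.length = 1 ∨ (1 < η.length ∧ Sat φ η.tail)
  | .untl φ ψ, η => ∃ i < η.length, Sat ψ (η.drop i) ∧ ∀ j < i, Sat φ (η.drop j)
  | .rel φ ψ, η => (∀ i < η.length, Sat ψ (η.drop i)) ∨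
      ∃ i < η.length, Sat φ (η.drop i) ∧ ∀ j ≤ i, Sat ψ (η.drop j)

/-- Infinite-trace (standard LTL) satisfaction, for reading (Xw-free) formulas as LTL.
(The `wnext` clause coincides with `next`; it is irrelevant for Xw-free formulas.) -/
def SatInf {P : Type} : LTLf P → (ℕ → State P) → Prop
  | .tt, _ => True
  | .ff, _ => False
  | .pos p, ξ => Lit.pos p ∈ ξ 0
  | .neg p, ξ => Lit.neg p ∈ ξ 0
  | .and φ ψ, ξ => SatInf φ ξ ∧ SatInf ψ ξ
  | .or φ ψ, ξ => SatInf φ ξ ∨ SatInf ψ ξ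
  | .next φ, ξ => SatInf φ (fun n => ξ (n + 1))
  | .wnext φ, ξ => SatInf φ (fun n => ξ (n + 1))
  | .untl φ ψ, ξ => ∃ i, SatInf ψ (fun n => ξ (n + i)) ∧ ∀ j < i, SatInf φ (fun n => ξ (n + j))
  | .rel φ ψ, ξ => (∀ i, SatInf ψ (fun n => ξ (n + i))) ∨
      ∃ i, SatInf φ (fun n => ξ (n + i)) ∧ ∀ j ≤ i, SatInf ψ (fun n => ξ (n + j))

/-- A formula is Xw-free iff it contains no `Xw` operator. -/
def XwFree {P : Type} : LTLf P → Prop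
  | .wnext _ => False
  | .and φ ψ | .or φ ψ | .untl φ ψ | .rel φ ψ => XwFree φ ∧ XwFree ψ
  | .next φ => XwFree φ
  | _ => True

/-- Propositional satisfaction `ω ⊨ α` (only meaningful for propositional formulas). -/
def PSat {P : Type} (ω : State P) : LTLf P → Prop
  | .tt => True
  | .ff => False
  | .pos p => Lit.pos p ∈ ω
  | .neg p => Lit.neg p ∈ ω
  | .and α β => PSat ω α ∧ PSat ω β
  | .or α β => PSat ω α ∨ PSat ω β
  | _ => False

/-- `DF φ`: the set of disjuncts of `φ`. -/
def DF {P : Type} : LTLf P → Set (LTLf P)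
  | .or φ ψ => DF φ ∪ DF ψ
  | φ => {φ}

/-- `CF φ`: the set of conjuncts of `φ`. -/
def CF {P : Type} : LTLf P → Set (LTLf P)
  | .and φ ψ => CF φ ∪ CF ψ
  | φ => {φ}

/-- `CF(α)` viewed as a single state: the set of literals occurring as conjuncts of `α`. -/
def litsOf {P : Type} : LTLf P → State P
  | .and α β => litsOf α ∪ litsOf β
  | .pos p => {Lit.pos p}
  | .neg p => {Lit.neg p}
  | _ => ∅

/-- `NFmem φ α ψ` means the clause `α ∧ X(ψ)` belongs to the normal form `NF(φ)`. -/
inductive NFmem {P : Type} : LTLf P → LTLf P → LTLf P → Prop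
  | tt : NFmem .tt .tt .tt
  | pos (p : P) : NFmem (.pos p) (.pos p) .tt
  | neg (p : P) : NFmem (.neg p) (.neg p) .tt
  | next {φ ψ : LTLf P} : ψ ∈ DF φ → NFmem (.next φ) .tt ψ
  | wnext {φ ψ : LTLf P} : ψ ∈ DF φ → NFmem (.wnext φ) .tt ψ
  | untl₁ {φ₁ φ₂ α ψ : LTLf P} : NFmem φ₂ α ψ → NFmem (.untl φ₁ φ₂) α ψ
  | untl₂ {φ₁ φ₂ α ψ : LTLf P} :
      NFmem (.and φ₁ (.next (.untl φ₁ φ₂))) α ψ → NFmem (.untl φ₁ φ₂) α ψ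
  | rel₁ {φ₁ φ₂ α ψ : LTLf P} : NFmem (.and φ₁ φ₂) α ψ → NFmem (.rel φ₁ φ₂) α ψ
  | rel₂ {φ₁ φ₂ α ψ : LTLf P} :
      NFmem (.and φ₂ (.next (.rel φ₁ φ₂))) α ψ → NFmem (.rel φ₁ φ₂) α ψ
  | or₁ {φ₁ φ₂ α ψ : LTLf P} : NFmem φ₁ α ψ → NFmem (.or φ₁ φ₂) α ψ
  | or₂ {φ₁ φ₂ α ψ : LTLf P} : NFmem φ₂ α ψ → NFmem (.or φ₁ φ₂) α ψ
  | and' {φ₁ φ₂ α₁ ψ₁ α₂ ψ₂ : LTLf P} : NFmem φ₁ α₁ ψ₁ → NFmem φ₂ α₂ ψ₂ →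
      NFmem (.and φ₁ φ₂) (.and α₁ α₂) (.and ψ₁ ψ₂)

/-- One transition step of the transition system `T_φ`. -/
def Step {P : Type} (ψ₁ ψ₂ : LTLf P) : Prop := ∃ α, NFmem ψ₁ α ψ₂

/-- Reachability in the transition system by a finite sequence of transitions. -/
def Reachable {P : Type} (φ ψ : LTLf P) : Prop := Relation.ReflTransGen Step φ ψ

/-- A state `ψ₁` is accepting iff some transition `ψ₁ →α ψ₂` satisfies `CF(α) ⊨ ψ₁`. -/
def Accepting {P : Type} (ψ₁ : LTLf P) : Prop :=
  ∃ α ψ₂, NFmem ψ₁ α ψ₂ ∧ Sat ψ₁ [litsOf α]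

/-- The release obligation formula `ofr`. -/
def ofr {P : Type} : LTLf P → LTLf P
  | .tt => .tt
  | .ff => .ff
  | .pos p => .pos p
  | .neg p => .neg p
  | .and φ ψ => .and (ofr φ) (ofr ψ)
  | .or φ ψ => .or (ofr φ) (ofr ψ)
  | .next _ => .ff
  | .wnext _ => .ff
  | .untl _ ψ => ofr ψ
  | .rel _ ψ => ofr ψ

/-- The global obligation formula `ofg`. -/
def ofg {P : Type} : LTLf P → LTLf P
  | .tt => .tt
  | .ff => .ff
  | .pos p => .pos p
  | .neg p => .neg p
  | .and φ ψ => .and (ofg φ) (ofg ψ)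
  | .or φ ψ => .or (ofg φ) (ofg ψ)
  | .next _ => .ff
  | .wnext _ => .tt
  | .untl _ ψ => ofg ψ
  | .rel _ ψ => ofg ψ

/-- The general obligation formula `off`. -/
def off {P : Type} : LTLf P → LTLf P
  | .tt => .tt
  | .ff => .ff
  | .pos p => .pos p
  | .neg p => .neg p
  | .and φ ψ => .and (off φ) (off ψ)
  | .or φ ψ => .or (off φ) (off ψ)
  | .next φ => off φ
  | .wnext φ => off φ
  | .untl _ ψ => off ψ
  | .rel _ ψ => ofr ψ


theorem sat_singleton_mono {P : Type} {ω ω' : State P} (h : ω ⊆ ω') (φ : LTLf P) :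
    Sat φ [ω] → Sat φ [ω'] := by
  induction φ with
  | tt | ff | next => simp [Sat]
  | wnext => simp [Sat]
  | pos p | neg p => simpa [Sat] using @h _
  | and φ ψ ihφ ihψ => exact And.imp ihφ ihψ
  | or φ ψ ihφ ihψ => exact Or.imp ihφ ihψ
  | untl φ ψ ihφ ihψ => simpa [Sat] using ihψ
  | rel φ ψ ihφ ihψ =>
    simp only [Sat, List.length_singleton, Nat.lt_one_iff, forall_eq, exists_eq_left,
      List.drop_zero, Nat.le_zero]
    exact Or.imp ihψ (And.imp ihφ ihψ)

theorem litsOf_subset_of_PSat {P : Type} {ω : State P} (α : LTLf P) (h : PSat ω α) :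
    litsOf α ⊆ ω := by
  induction α with
  | and α β ihα ihβ => exact Set.union_subset (ihα h.1) (ihβ h.2)
  | pos p | neg p => exact Set.singleton_subset_iff.2 h
  | _ => exact Set.empty_subset _

theorem sat_of_mem_DF {P : Type} {η : List (State P)} {ψ : LTLf P} (φ : LTLf P)
    (h : ψ ∈ DF φ) (hs : Sat ψ η) : Sat φ η := by
  induction φ with
  | or φ₁ φ₂ ih₁ ih₂ => exact Or.imp ih₁ ih₂ h
  | _ => exact Set.mem_singleton_iff.1 h ▸ hs

theorem exists_mem_DF_sat {P : Type} {η : List (State P)} (φ : LTLf P) (h : Sat φ η) :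
    ∃ ψ ∈ DF φ, Sat ψ η := by
  induction φ with
  | or φ₁ φ₂ ih₁ ih₂ =>
    rcases h with h | h
    · obtain ⟨ψ, hm, hs⟩ := ih₁ h
      exact ⟨ψ, Or.inl hm, hs⟩
    · obtain ⟨ψ, hm, hs⟩ := ih₂ h
      exact ⟨ψ, Or.inr hm, hs⟩
  | _ => exact ⟨_, rfl, h⟩

theorem DF_nonempty {P : Type} (φ : LTLf P) : (DF φ).Nonempty := by
  induction φ with
  | or φ₁ φ₂ ih₁ ih₂ => exact ih₁.inl
  | _ => exact Set.singleton_nonempty _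

theorem sat_next_cons {P : Type} {ω : State P} {η : List (State P)} (hη : η ≠ [])
    (φ : LTLf P) : Sat (.next φ) (ω :: η) ↔ Sat φ η := by
  simp [Sat, List.length_pos_iff, hη]

theorem sat_wnext_cons {P : Type} {ω : State P} {η : List (State P)} (hη : η ≠ [])
    (φ : LTLf P) : Sat (.wnext φ) (ω :: η) ↔ Sat φ η := by
  simp [Sat, List.length_pos_iff, hη]

/-- The expansion law for `U`. -/
theorem sat_untl_cons {P : Type} {ω : State P} {η : List (State P)} (φ ψ : LTLf P) :
    Sat (.untl φ ψ) (ω :: η) ↔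
      Sat ψ (ω :: η) ∨ Sat φ (ω :: η) ∧ Sat (.untl φ ψ) η := by
  constructor
  · rintro ⟨i, hi, hψ, hφ⟩
    cases i with
    | zero => exact Or.inl hψ
    | succ i =>
      exact Or.inr ⟨hφ 0 i.succ_pos, i, Nat.lt_of_succ_lt_succ hi, hψ,
        fun j hj => hφ (j + 1) (Nat.succ_lt_succ hj)⟩
  · rintro (hψ | ⟨h0, i, hi, hψ, hφ⟩)
    · exact ⟨0, Nat.succ_pos _, hψ, fun j hj => absurd hj j.not_lt_zero⟩
    · refine ⟨i + 1, Nat.succ_lt_succ hi, hψ, fun j hj => ?_⟩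
      cases j with
      | zero => exact h0
      | succ j => exact hφ j (Nat.lt_of_succ_lt_succ hj)

/-- The expansion law for `R`. -/
theorem sat_rel_cons {P : Type} {ω : State P} {η : List (State P)} (φ ψ : LTLf P) :
    Sat (.rel φ ψ) (ω :: η) ↔
      Sat φ (ω :: η) ∧ Sat ψ (ω :: η) ∨ Sat ψ (ω :: η) ∧ Sat (.rel φ ψ) η := by
  constructor
  · rintro (h | ⟨i, hi, hφ, hψ⟩)
    · exact Or.inr ⟨h 0 (Nat.succ_pos _), Or.inl fun i hi => h (i + 1) (Nat.succ_lt_succ hi)⟩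
    · cases i with
      | zero => exact Or.inl ⟨hφ, hψ 0 le_rfl⟩
      | succ i =>
        exact Or.inr ⟨hψ 0 (Nat.zero_le _), Or.inr ⟨i, Nat.lt_of_succ_lt_succ hi, hφ,
          fun j hj => hψ (j + 1) (Nat.succ_le_succ hj)⟩⟩
  · rintro (⟨hφ, hψ⟩ | ⟨h0, h | ⟨i, hi, hφ, hψ⟩⟩)
    · refine Or.inr ⟨0, Nat.succ_pos _, hφ, fun j hj => ?_⟩
      obtain rfl := Nat.le_zero.1 hj
      exact hψ
    · refine Or.inl fun i hi => ?_
      cases i with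
      | zero => exact h0
      | succ i => exact h i (Nat.lt_of_succ_lt_succ hi)
    · refine Or.inr ⟨i + 1, Nat.succ_lt_succ hi, hφ, fun j hj => ?_⟩
      cases j with
      | zero => exact h0
      | succ j => exact hψ j (Nat.le_of_succ_le_succ hj)

theorem NFmem.sat_cons {P : Type} {ω : State P} {η : List (State P)} (hη : η ≠ [])
    {φ α ψ : LTLf P} (h : NFmem φ α ψ) (hα : PSat ω α) (hψ : Sat ψ η) : Sat φ (ω :: η) := by
  induction h with
  | tt => trivial
  | pos p | neg p => exact hα
  | next hm => exact (sat_next_cons hη _).2 (sat_of_mem_DF _ hm hψ)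
  | wnext hm => exact (sat_wnext_cons hη _).2 (sat_of_mem_DF _ hm hψ)
  | untl₁ _ ih => exact (sat_untl_cons _ _).2 (Or.inl (ih hα hψ))
  | untl₂ _ ih =>
    exact (sat_untl_cons _ _).2 (Or.inr ((ih hα hψ).imp_right (sat_next_cons hη _).1))
  | rel₁ _ ih => exact (sat_rel_cons _ _).2 (Or.inl (ih hα hψ))
  | rel₂ _ ih =>
    exact (sat_rel_cons _ _).2 (Or.inr ((ih hα hψ).imp_right (sat_next_cons hη _).1))
  | or₁ _ ih => exact Or.inl (ih hα hψ)
  | or₂ _ ih => exact Or.inr (ih hα hψ)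
  | and' _ _ ih₁ ih₂ => exact ⟨ih₁ hα.1 hψ.1, ih₂ hα.2 hψ.2⟩

theorem exists_NFmem_of_sat_cons {P : Type} {ω : State P} {η : List (State P)} (hη : η ≠ [])
    (φ : LTLf P) (h : Sat φ (ω :: η)) : ∃ α ψ, NFmem φ α ψ ∧ PSat ω α ∧ Sat ψ η := by
  induction φ with
  | tt => exact ⟨_, _, .tt, trivial, trivial⟩
  | ff => exact h.elim
  | pos p => exact ⟨_, _, .pos p, h, trivial⟩
  | neg p => exact ⟨_, _, .neg p, h, trivial⟩
  | and φ₁ φ₂ ih₁ ih₂ =>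
    obtain ⟨α₁, ψ₁, hm₁, hα₁, hψ₁⟩ := ih₁ h.1
    obtain ⟨α₂, ψ₂, hm₂, hα₂, hψ₂⟩ := ih₂ h.2
    exact ⟨_, _, .and' hm₁ hm₂, ⟨hα₁, hα₂⟩, hψ₁, hψ₂⟩
  | or φ₁ φ₂ ih₁ ih₂ =>
    rcases h with h | h
    · obtain ⟨α, ψ, hm, hs⟩ := ih₁ h
      exact ⟨α, ψ, .or₁ hm, hs⟩
    · obtain ⟨α, ψ, hm, hs⟩ := ih₂ h
      exact ⟨α, ψ, .or₂ hm, hs⟩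
  | next φ ih =>
    obtain ⟨ψ, hm, hs⟩ := exists_mem_DF_sat φ ((sat_next_cons hη φ).1 h)
    exact ⟨_, ψ, .next hm, trivial, hs⟩
  | wnext φ ih =>
    obtain ⟨ψ, hm, hs⟩ := exists_mem_DF_sat φ ((sat_wnext_cons hη φ).1 h)
    exact ⟨_, ψ, .wnext hm, trivial, hs⟩
  | untl φ₁ φ₂ ih₁ ih₂ =>
    rcases (sat_untl_cons _ _).1 h with h | ⟨h₁, hu⟩
    · obtain ⟨α, ψ, hm, hs⟩ := ih₂ h
      exact ⟨α, ψ, .untl₁ hm, hs⟩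
    · obtain ⟨α, ψ, hm, hα, hψ⟩ := ih₁ h₁
      exact ⟨_, _, .untl₂ (.and' hm (.next rfl)), ⟨hα, trivial⟩, hψ, hu⟩
  | rel φ₁ φ₂ ih₁ ih₂ =>
    rcases (sat_rel_cons _ _).1 h with ⟨h₁, h₂⟩ | ⟨h₂, hr⟩
    · obtain ⟨α₁, ψ₁, hm₁, hα₁, hψ₁⟩ := ih₁ h₁
      obtain ⟨α₂, ψ₂, hm₂, hα₂, hψ₂⟩ := ih₂ h₂
      exact ⟨_, _, .rel₁ (.and' hm₁ hm₂), ⟨hα₁, hα₂⟩, hψ₁, hψ₂⟩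
    · obtain ⟨α, ψ, hm, hα, hψ⟩ := ih₂ h₂
      exact ⟨_, _, .rel₂ (.and' hm (.next rfl)), ⟨hα, trivial⟩, hψ, hr⟩

theorem exists_NFmem_of_sat_singleton {P : Type} {ω : State P} (φ : LTLf P) (h : Sat φ [ω]) :
    ∃ α ψ, NFmem φ α ψ ∧ PSat ω α ∧ Sat φ [litsOf α] := by
  induction φ with
  | tt => exact ⟨_, _, .tt, trivial, trivial⟩
  | ff => exact h.elim
  | pos p => exact ⟨_, _, .pos p, h, Set.mem_singleton _⟩
  | neg p => exact ⟨_, _, .neg p, h, Set.mem_singleton _⟩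
  | and φ₁ φ₂ ih₁ ih₂ =>
    obtain ⟨α₁, ψ₁, hm₁, hα₁, hs₁⟩ := ih₁ h.1
    obtain ⟨α₂, ψ₂, hm₂, hα₂, hs₂⟩ := ih₂ h.2
    exact ⟨_, _, .and' hm₁ hm₂, ⟨hα₁, hα₂⟩,
      sat_singleton_mono Set.subset_union_left _ hs₁,
      sat_singleton_mono Set.subset_union_right _ hs₂⟩
  | or φ₁ φ₂ ih₁ ih₂ =>
    rcases h with h | h
    · obtain ⟨α, ψ, hm, hα, hs⟩ := ih₁ h
      exact ⟨α, ψ, .or₁ hm, hα, Or.inl hs⟩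
    · obtain ⟨α, ψ, hm, hα, hs⟩ := ih₂ h
      exact ⟨α, ψ, .or₂ hm, hα, Or.inr hs⟩
  | next φ ih => exact absurd h.1 (lt_irrefl 1)
  | wnext φ ih =>
    obtain ⟨ψ, hm⟩ := DF_nonempty φ
    exact ⟨_, ψ, .wnext hm, trivial, Or.inl rfl⟩
  | untl φ₁ φ₂ ih₁ ih₂ =>
    obtain ⟨α, ψ, hm, hα, hs⟩ := ih₂ (by simpa [Sat] using h)
    exact ⟨α, ψ, .untl₁ hm, hα, (sat_untl_cons _ _).2 (Or.inl hs)⟩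
  | rel φ₁ φ₂ ih₁ ih₂ =>
    have h₂ : Sat φ₂ [ω] := ((sat_rel_cons _ _).1 h).elim And.right And.left
    obtain ⟨α, ψ, hm, hα, hs⟩ := ih₂ h₂
    exact ⟨_, _, .rel₂ (.and' hm (.next rfl)), ⟨hα, trivial⟩, (sat_rel_cons _ _).2
      (Or.inr ⟨sat_singleton_mono Set.subset_union_left _ hs, Or.inl (by simp)⟩)⟩

/-- `η ⊨ φ` iff there is a run `φ = φ₀ →α₀ … →αₙ φₙ₊₁` of `T_φ` on `η`
whose last transition `φₙ →αₙ φₙ₊₁` satisfies `CF(αₙ) ⊨ φₙ`, where `CF(αₙ)` is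
viewed as the length-1 trace `[litsOf (αs (η.length - 1))]`. -/
theorem stmt4 {P : Type} (φ : LTLf P) (η : List (State P)) (hη : η ≠ []) :
    Sat φ η ↔ ∃ (φs αs : ℕ → LTLf P), φs 0 = φ ∧
      (∀ i < η.length, NFmem (φs i) (αs i) (φs (i + 1)) ∧ PSat (η.getD i ∅) (αs i)) ∧
      Sat (φs (η.length - 1)) [litsOf (αs (η.length - 1))] := by
  induction η generalizing φ with
  | nil => exact absurd rfl hη
  | cons ω η ih =>
    rcases η with _ | ⟨ω', η⟩
    · constructor
      · intro h
        obtain ⟨α, ψ, hm, hα, hs⟩ := exists_NFmem_of_sat_singleton φ h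
        refine ⟨fun | 0 => φ | _ + 1 => ψ, fun _ => α, rfl, fun i hi => ?_, hs⟩
        obtain rfl := Nat.lt_one_iff.1 hi
        exact ⟨hm, hα⟩
      · rintro ⟨φs, αs, rfl, hrun, hs⟩
        exact sat_singleton_mono (litsOf_subset_of_PSat _ (hrun 0 Nat.one_pos).2) _ hs
    · have hne : ω' :: η ≠ [] := List.cons_ne_nil _ _
      constructor
      · intro h
        obtain ⟨α, ψ, hm, hα, hψ⟩ := exists_NFmem_of_sat_cons hne φ h
        obtain ⟨φs, αs, rfl, hrun, hs⟩ := (ih ψ hne).1 hψ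
        refine ⟨fun | 0 => φ | n + 1 => φs n, fun | 0 => α | n + 1 => αs n, rfl,
          fun i hi => ?_, hs⟩
        cases i with
        | zero => exact ⟨hm, hα⟩
        | succ i => exact hrun i (Nat.lt_of_succ_lt_succ hi)
      · rintro ⟨φs, αs, rfl, hrun, hs⟩
        have h0 := hrun 0 (Nat.succ_pos _)
        exact h0.1.sat_cons hne h0.2 ((ih _ hne).2 ⟨fun n => φs (n + 1), fun n => αs (n + 1), rfl,
          fun i hi => hrun (i + 1) (Nat.succ_lt_succ hi), hs⟩)

end LTLfPaper
end

section
/- Let φ be an LTLf formula and A ∈ Σ with A ⊨ off(φ) (propositional satisfaction). Then there exists n ≥ 1 such that the finite trace A^n = AA…A (n copies of the state A) satisfies φ. -/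
namespace LTLfPaper

/-- If `A ⊨ ofr(φ)`, then every nonempty constant trace of `A` satisfies `φ`. -/
theorem sat_replicate_of_psat_ofr {P : Type} (φ : LTLf P) (A : State P)
    (h : PSat A (ofr φ)) (n : ℕ) (hn : 1 ≤ n) : Sat φ (List.replicate n A) := by
  induction φ generalizing n with
  | tt => trivial
  | ff => exact h
  | pos p =>
    obtain ⟨k, rfl⟩ := Nat.exists_eq_add_of_le' hn
    simpa [Sat, PSat, ofr, List.replicate_succ] using h
  | neg p =>
    obtain ⟨k, rfl⟩ := Nat.exists_eq_add_of_le' hn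
    simpa [Sat, PSat, ofr, List.replicate_succ] using h
  | and φ ψ ihφ ihψ => exact ⟨ihφ h.1 n hn, ihψ h.2 n hn⟩
  | or φ ψ ihφ ihψ => exact h.imp (fun h => ihφ h n hn) (fun h => ihψ h n hn)
  | next φ _ => exact h.elim
  | wnext φ _ => exact h.elim
  | untl φ ψ _ ihψ =>
    exact ⟨0, by rwa [List.length_replicate], by simpa using ihψ h n hn, by simp⟩
  | rel φ ψ _ ihψ =>
    refine Or.inl fun i hi => ?_
    rw [List.length_replicate] at hi
    rw [List.drop_replicate]
    exact ihψ h (n - i) (by omega)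

/-- If `A ⊨ off(φ)`, then every sufficiently long constant trace of `A` satisfies `φ`. -/
theorem eventually_sat_replicate_of_psat_off {P : Type} (φ : LTLf P) (A : State P)
    (h : PSat A (off φ)) : ∃ n ≥ 1, ∀ m ≥ n, Sat φ (List.replicate m A) := by
  induction φ with
  | tt => exact ⟨1, le_rfl, fun _ _ => trivial⟩
  | ff => exact h.elim
  | pos p => exact ⟨1, le_rfl, sat_replicate_of_psat_ofr (.pos p) A h⟩
  | neg p => exact ⟨1, le_rfl, sat_replicate_of_psat_ofr (.neg p) A h⟩
  | and φ ψ ihφ ihψ =>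
    obtain ⟨k, hk, hφ⟩ := ihφ h.1
    obtain ⟨l, _, hψ⟩ := ihψ h.2
    exact ⟨max k l, le_max_of_le_left hk, fun m hm =>
      ⟨hφ m (le_of_max_le_left hm), hψ m (le_of_max_le_right hm)⟩⟩
  | or φ ψ ihφ ihψ =>
    rcases h with h | h
    · obtain ⟨n, hn, hφ⟩ := ihφ h
      exact ⟨n, hn, fun m hm => Or.inl (hφ m hm)⟩
    · obtain ⟨n, hn, hψ⟩ := ihψ h
      exact ⟨n, hn, fun m hm => Or.inr (hψ m hm)⟩
  | next φ ih =>
    obtain ⟨n, hn, hφ⟩ := ih h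
    refine ⟨n + 1, by omega, fun m hm => ⟨by rw [List.length_replicate]; omega, ?_⟩⟩
    rw [List.tail_replicate]
    exact hφ (m - 1) (by omega)
  | wnext φ ih =>
    obtain ⟨n, hn, hφ⟩ := ih h
    refine ⟨n + 1, by omega, fun m hm => Or.inr ⟨by rw [List.length_replicate]; omega, ?_⟩⟩
    rw [List.tail_replicate]
    exact hφ (m - 1) (by omega)
  | untl φ ψ _ ihψ =>
    obtain ⟨n, hn, hψ⟩ := ihψ h
    exact ⟨n, hn, fun m hm =>
      ⟨0, by rw [List.length_replicate]; omega, by simpa using hψ m hm, by simp⟩⟩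
  | rel φ ψ _ _ => exact ⟨1, le_rfl, sat_replicate_of_psat_ofr (.rel φ ψ) A h⟩

/-- If `A ⊨ off(φ)` propositionally, then some finite trace `A^n`
(`n ≥ 1` copies of the state `A`) satisfies `φ`. -/
theorem stmt9 {P : Type} (φ : LTLf P) (A : State P) (h : PSat A (off φ)) :
    ∃ n ≥ 1, Sat φ (List.replicate n A) := by
  obtain ⟨n, hn, hφ⟩ := eventually_sat_replicate_of_psat_off φ A h
  exact ⟨n, hn, hφ n le_rfl⟩

end LTLfPaper
end
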